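/- arXiv:2210.09957 — 7 statements merged into one kernel-verified Lean document; each statement's English description precedes it below -/
import Mathlib

section
/- Let D be a positive integer, K ⊆ ℝ^D a compact convex set with diameter D_K = sup_{z,z'∈K} ‖z − z'‖₂, and S ⊆ K a nonempty compact set. Let f : ℝ^D → ℝ be concave, differentiable on an open set containing K, with gradient C-Lipschitz continuous (with respect to ‖·‖₂) on K. Fix an integer T ≥ 1, a point z₀ ∈ K and points ρ₁, …, ρ_T ∈ K, and define the Frank–Wolfe averaging iterates z_τ = z_{τ−1} + (1/τ)(ρ_τ − z_{τ−1}) for τ = 1, …, T. Then T · ( sup_{s∈S} f(s) − f(z_T) ) ≤ ∑_{τ=1}^T sup_{s∈S} ⟨∇f(z_{τ−1}), s − ρ_τ⟩ + (C · D_K² / 2) · (1 + ln T). -/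
open scoped RealInnerProductSpace BigOperators

section

variable {E : Type*} [NormedAddCommGroup E] [InnerProductSpace ℝ E] [CompleteSpace E]

theorem hasDerivAt_comp_add_smul_of_differentiableAt {f : E → ℝ} {x v : E} {t : ℝ}
    (hf : DifferentiableAt ℝ f (x + t • v)) :
    HasDerivAt (fun r : ℝ => f (x + r • v)) ⟪gradient f (x + t • v), v⟫ t := by
  have hline : HasDerivAt (fun r : ℝ => x + r • v) v t := by
    simpa using ((hasDerivAt_id t).smul_const v).const_add x
  simpa [Function.comp_def] using hf.hasGradientAt.hasFDerivAt.comp_hasDerivAt t hline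

/-- A concave function lies below its tangent planes. -/
theorem ConcaveOn.sub_le_inner_gradient {f : E → ℝ} (hf : ConcaveOn ℝ Set.univ f) {x : E}
    (hx : DifferentiableAt ℝ f x) (y : E) : f y - f x ≤ ⟪gradient f x, y - x⟫ := by
  have hconc : ConcaveOn ℝ Set.univ (fun r : ℝ => f (x + r • (y - x))) := by
    have h := hf.comp_affineMap (AffineMap.lineMap (k := ℝ) x y)
    simpa [Function.comp_def, AffineMap.lineMap_apply, add_comm] using h
  have hderiv : HasDerivAt (fun r : ℝ => f (x + r • (y - x))) ⟪gradient f x, y - x⟫ 0 := by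
    simpa using hasDerivAt_comp_add_smul_of_differentiableAt (f := f) (x := x) (v := y - x)
      (t := 0) (by simpa using hx)
  simpa [slope_def_field] using
    hconc.slope_le_of_hasDerivAt (Set.mem_univ 0) (Set.mem_univ 1) one_pos hderiv

/-- The descent lemma for a function whose gradient is `C`-Lipschitz on a convex set. -/
theorem Convex.add_inner_gradient_sub_le {f : E → ℝ} {K : Set E} (hK : Convex ℝ K)
    (hdiff : ∀ w ∈ K, DifferentiableAt ℝ f w) {C : ℝ}
    (hgrad : ∀ w ∈ K, ∀ w' ∈ K, ‖gradient f w - gradient f w'‖ ≤ C * ‖w - w'‖)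
    {x v : E} (hx : x ∈ K) (hxv : x + v ∈ K) :
    f x + ⟪gradient f x, v⟫ - C / 2 * ‖v‖ ^ 2 ≤ f (x + v) := by
  have hmem : ∀ t ∈ Set.Icc (0 : ℝ) 1, x + t • v ∈ K := fun t ht =>
    hK.add_smul_mem hx hxv ht
  have hderiv : ∀ t ∈ Set.Icc (0 : ℝ) 1, HasDerivAt
      (fun r : ℝ => f (x + r • v) - r * ⟪gradient f x, v⟫ + C / 2 * ‖v‖ ^ 2 * r ^ 2)
      (⟪gradient f (x + t • v), v⟫ - ⟪gradient f x, v⟫ + C / 2 * ‖v‖ ^ 2 * (2 * t)) t := by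
    intro t ht
    have h := hasDerivAt_comp_add_smul_of_differentiableAt (hdiff _ (hmem t ht))
    simpa [Pi.add_def, Pi.sub_def] using (h.sub ((hasDerivAt_id t).mul_const ⟪gradient f x, v⟫)).add
      ((hasDerivAt_pow 2 t).const_mul (C / 2 * ‖v‖ ^ 2))
  have hmono : MonotoneOn
      (fun r : ℝ => f (x + r • v) - r * ⟪gradient f x, v⟫ + C / 2 * ‖v‖ ^ 2 * r ^ 2)
      (Set.Icc 0 1) := by
    refine monotoneOn_of_deriv_nonneg (convex_Icc 0 1)
      (fun t ht => (hderiv t ht).continuousAt.continuousWithinAt)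
      (fun t ht => (hderiv t (interior_subset ht)).differentiableAt.differentiableWithinAt) ?_
    intro t ht
    have ht' := interior_subset ht
    rw [(hderiv t ht').deriv, ← inner_sub_left]
    have hinner := neg_le_of_abs_le
      (abs_real_inner_le_norm (gradient f (x + t • v) - gradient f x) v)
    have hnorm := hgrad _ (hmem t ht') x hx
    rw [add_sub_cancel_left, norm_smul, Real.norm_of_nonneg ht'.1] at hnorm
    nlinarith [mul_le_mul_of_nonneg_right hnorm (norm_nonneg v)]
  have h := hmono (Set.left_mem_Icc.2 zero_le_one) (Set.right_mem_Icc.2 zero_le_one) zero_le_one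
  simp only [zero_smul, add_zero, one_smul, zero_mul, one_mul] at h
  linarith

end

/-- Deterministic Frank–Wolfe telescoping bound (smooth objective case). -/
theorem fw_telescoping_smooth (D : ℕ) (hD : 0 < D)
    (K S : Set (EuclideanSpace ℝ (Fin D)))
    (hKcomp : IsCompact K) (hKconv : Convex ℝ K)
    (hSK : S ⊆ K) (hScomp : IsCompact S) (hSne : S.Nonempty)
    (f : EuclideanSpace ℝ (Fin D) → ℝ)
    (hconc : ConcaveOn ℝ Set.univ f)
    (U : Set (EuclideanSpace ℝ (Fin D))) (hUopen : IsOpen U) (hKU : K ⊆ U)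
    (hdiff : DifferentiableOn ℝ f U)
    (C : ℝ) (hC : 0 ≤ C)
    (hgrad : ∀ z ∈ K, ∀ z' ∈ K,
      ‖gradient f z - gradient f z'‖ ≤ C * ‖z - z'‖)
    (T : ℕ) (hT : 1 ≤ T)
    (z ρ : ℕ → EuclideanSpace ℝ (Fin D))
    (hz0 : z 0 ∈ K) (hρ : ∀ τ ∈ Finset.Icc 1 T, ρ τ ∈ K)
    (hz : ∀ τ ∈ Finset.Icc 1 T,
      z τ = z (τ - 1) + ((τ : ℝ)⁻¹) • (ρ τ - z (τ - 1))) :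
    (T : ℝ) * (sSup (f '' S) - f (z T)) ≤
      (∑ τ ∈ Finset.Icc 1 T,
        sSup ((fun s => ⟪gradient f (z (τ - 1)), s - ρ τ⟫) '' S))
      + (C * (Metric.diam K) ^ 2 / 2) * (1 + Real.log T) := by
  have hdiffK : ∀ w ∈ K, DifferentiableAt ℝ f w := fun w hw =>
    hdiff.differentiableAt (hUopen.mem_nhds (hKU hw))
  obtain ⟨s, hs, hsmax⟩ := hScomp.exists_sSup_image_eq hSne
    (fun w hw => (hdiffK w (hSK hw)).continuousAt.continuousWithinAt)
  have hzK : ∀ n ≤ T, z n ∈ K := by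
    intro n
    induction n with
    | zero => exact fun _ => hz0
    | succ n ih =>
      intro hn
      have hmem : n + 1 ∈ Finset.Icc 1 T := Finset.mem_Icc.2 ⟨by omega, hn⟩
      rw [hz _ hmem]
      exact hKconv.add_smul_sub_mem (ih (by omega)) (hρ _ hmem)
        ⟨by positivity, inv_le_one_of_one_le₀ (by simp)⟩
  have hstep : ∀ n < T, ((n + 1 : ℕ) : ℝ) * (f s - f (z (n + 1))) ≤
      n * (f s - f (z n)) + sSup ((fun w => ⟪gradient f (z n), w - ρ (n + 1)⟫) '' S)
        + C * Metric.diam K ^ 2 / 2 * ((n + 1 : ℕ) : ℝ)⁻¹ := by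
    intro n hn
    have hmem : n + 1 ∈ Finset.Icc 1 T := Finset.mem_Icc.2 ⟨by omega, hn⟩
    have hzn := hzK n hn.le
    have hznext : z (n + 1) = z n + ((n + 1 : ℕ) : ℝ)⁻¹ • (ρ (n + 1) - z n) := hz _ hmem
    have hsmooth := hKconv.add_inner_gradient_sub_le hdiffK hgrad hzn (hznext ▸ hzK _ hn)
    rw [← hznext, inner_smul_right, norm_smul, mul_pow, norm_inv, Real.norm_natCast] at hsmooth
    have htangent := hconc.sub_le_inner_gradient (hdiffK _ hzn) s
    have hsup : ⟪gradient f (z n), s - ρ (n + 1)⟫ ≤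
        sSup ((fun w => ⟪gradient f (z n), w - ρ (n + 1)⟫) '' S) :=
      le_csSup (hScomp.bddAbove_image (by fun_prop)) (Set.mem_image_of_mem _ hs)
    have hsplit : ⟪gradient f (z n), s - ρ (n + 1)⟫ =
        ⟪gradient f (z n), s - z n⟫ - ⟪gradient f (z n), ρ (n + 1) - z n⟫ := by
      rw [← inner_sub_right, sub_sub_sub_cancel_right]
    have hdiam : ‖ρ (n + 1) - z n‖ ^ 2 ≤ Metric.diam K ^ 2 := by
      rw [← dist_eq_norm]
      gcongr
      exact Metric.dist_le_diam_of_mem hKcomp.isBounded (hρ _ hmem) hzn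
    have hpos : (0 : ℝ) < (n + 1 : ℕ) := by positivity
    have hscaled := mul_le_mul_of_nonneg_left hsmooth hpos.le
    have hexpand : ((n + 1 : ℕ) : ℝ) * (f (z n) +
          ((n + 1 : ℕ) : ℝ)⁻¹ * ⟪gradient f (z n), ρ (n + 1) - z n⟫
          - C / 2 * (((n + 1 : ℕ) : ℝ)⁻¹ ^ 2 * ‖ρ (n + 1) - z n‖ ^ 2)) =
        ((n + 1 : ℕ) : ℝ) * f (z n) + ⟪gradient f (z n), ρ (n + 1) - z n⟫
          - C / 2 * ((n + 1 : ℕ) : ℝ)⁻¹ * ‖ρ (n + 1) - z n‖ ^ 2 := by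
      field_simp
    rw [hexpand] at hscaled
    have herror : C / 2 * ((n + 1 : ℕ) : ℝ)⁻¹ * ‖ρ (n + 1) - z n‖ ^ 2 ≤
        C / 2 * ((n + 1 : ℕ) : ℝ)⁻¹ * Metric.diam K ^ 2 := by
      gcongr
    have hcast : ((n + 1 : ℕ) : ℝ) = n + 1 := by push_cast; rfl
    generalize ((n + 1 : ℕ) : ℝ)⁻¹ = a at *
    rw [hcast] at *
    linarith
  have hsum : ∀ n ≤ T, (n : ℝ) * (f s - f (z n)) ≤
      (∑ τ ∈ Finset.Icc 1 n, sSup ((fun w => ⟪gradient f (z (τ - 1)), w - ρ τ⟫) '' S))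
        + C * Metric.diam K ^ 2 / 2 * ∑ τ ∈ Finset.Icc 1 n, (τ : ℝ)⁻¹ := by
    intro n
    induction n with
    | zero => simp
    | succ n ih =>
      intro hn
      rw [Finset.sum_Icc_succ_top (by omega), Finset.sum_Icc_succ_top (by omega),
        Nat.add_sub_cancel]
      linarith [ih (by omega), hstep n hn]
  have hharmonic : ∑ τ ∈ Finset.Icc 1 T, (τ : ℝ)⁻¹ ≤ 1 + Real.log T := by
    simpa [harmonic_eq_sum_Icc] using harmonic_le_one_add_log T
  rw [hsmax]
  refine (hsum T le_rfl).trans ?_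
  gcongr
end

section
/- Let D be a positive integer, K ⊆ ℝ^D a compact convex set with diameter D_K = sup_{z,z'∈K} ‖z − z'‖₂, and S ⊆ K a nonempty compact set. Fix an integer T ≥ 1. For each τ = 0, 1, …, T let f_τ : ℝ^D → ℝ be concave, differentiable on an open set containing K, with gradient C_τ-Lipschitz continuous (with respect to ‖·‖₂) on K, and define R̃_τ(z) = sup_{s∈S} f_τ(s) − f_τ(z). Fix z₀ ∈ K and ρ₁, …, ρ_T ∈ K and define the Frank–Wolfe averaging iterates z_τ = z_{τ−1} + (1/τ)(ρ_τ − z_{τ−1}) for τ = 1, …, T. Then T · R̃_T(z_T) ≤ ∑_{τ=1}^T sup_{s∈S} ⟨∇f_{τ−1}(z_{τ−1}), s − ρ_τ⟩ + ∑_{τ=1}^T τ · ( R̃_τ(z_τ) − R̃_{τ−1}(z_τ) ) + ∑_{τ=1}^T D_K² · C_{τ−1} / (2τ). -/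
open scoped RealInnerProductSpace BigOperators

/-- A differentiable function has the expected derivative along a line. -/
lemma HasGradientAt.hasDerivAt_comp_add_smul {E : Type*} [NormedAddCommGroup E]
    [InnerProductSpace ℝ E] [CompleteSpace E] {f : E → ℝ} {g x v : E} {t : ℝ}
    (h : HasGradientAt f g (x + t • v)) :
    HasDerivAt (fun u : ℝ => f (x + u • v)) ⟪g, v⟫ t := by
  have hline : HasDerivAt (fun u : ℝ => x + u • v) v t := by
    simpa using ((hasDerivAt_id t).smul_const v).const_add x
  simpa [Function.comp_def] using h.hasFDerivAt.comp_hasDerivAt t hline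

/-- A concave function lies below its tangent hyperplanes. -/
lemma ConcaveOn.le_add_inner_of_hasGradientAt {E : Type*} [NormedAddCommGroup E]
    [InnerProductSpace ℝ E] [CompleteSpace E] {f : E → ℝ} {g x : E}
    (hf : ConcaveOn ℝ Set.univ f) (h : HasGradientAt f g x) (y : E) :
    f y ≤ f x + ⟪g, y - x⟫ := by
  have hconc : ConcaveOn ℝ Set.univ (fun u : ℝ => f (x + u • (y - x))) := by
    have := hf.comp_affineMap (AffineMap.lineMap x y : ℝ →ᵃ[ℝ] E)
    simpa [Function.comp_def, AffineMap.lineMap_apply, add_comm] using this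
  have hd : HasDerivAt (fun u : ℝ => f (x + u • (y - x))) ⟪g, y - x⟫ 0 :=
    HasGradientAt.hasDerivAt_comp_add_smul (by simpa using h)
  have hs := hconc.slope_le_of_hasDerivAt (Set.mem_univ 0) (Set.mem_univ 1) one_pos hd
  simp only [slope_def_field, one_smul, zero_smul, add_zero, add_sub_cancel, sub_zero,
    div_one] at hs
  linarith

/-- The descent lemma: a function with Lipschitz gradient on a convex set is bounded below by
its quadratic model. -/
lemma Convex.add_inner_sub_le_of_lipschitz_gradient {E : Type*} [NormedAddCommGroup E]
    [InnerProductSpace ℝ E] [CompleteSpace E] {K : Set E} (hK : Convex ℝ K) {f : E → ℝ} {c : ℝ}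
    (hf : ∀ x ∈ K, DifferentiableAt ℝ f x)
    (hgrad : ∀ x ∈ K, ∀ y ∈ K, ‖gradient f x - gradient f y‖ ≤ c * ‖x - y‖)
    {x v : E} (hx : x ∈ K) (hxv : x + v ∈ K) :
    f x + ⟪gradient f x, v⟫ - c / 2 * ‖v‖ ^ 2 ≤ f (x + v) := by
  have hmem : ∀ t ∈ Set.Icc (0 : ℝ) 1, x + t • v ∈ K := fun t ht =>
    hK.add_smul_mem hx hxv ht
  have hd : ∀ t ∈ Set.Icc (0 : ℝ) 1, HasDerivAt
      (fun u : ℝ => f (x + u • v) - u * ⟪gradient f x, v⟫ + u ^ 2 * (c / 2 * ‖v‖ ^ 2))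
      (⟪gradient f (x + t • v), v⟫ - ⟪gradient f x, v⟫ + t * (c * ‖v‖ ^ 2)) t := by
    intro t ht
    have h₁ := (hf _ (hmem t ht)).hasGradientAt.hasDerivAt_comp_add_smul
    have h₂ := (hasDerivAt_id t).mul_const ⟪gradient f x, v⟫
    have h₃ := (hasDerivAt_pow 2 t).mul_const (c / 2 * ‖v‖ ^ 2)
    refine ((h₁.sub h₂).add h₃).congr_deriv ?_
    push_cast
    ring
  have hmono := monotoneOn_of_deriv_nonneg (convex_Icc (0 : ℝ) 1)
    (fun t ht => (hd t ht).continuousAt.continuousWithinAt)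
    (fun t ht => (hd t (interior_subset ht)).differentiableAt.differentiableWithinAt)
    (fun t ht => by
      have ht' := interior_subset ht
      rw [(hd t ht').deriv, ← inner_sub_left]
      have h₁ := hgrad _ (hmem t ht') x hx
      rw [add_sub_cancel_left, norm_smul, Real.norm_of_nonneg ht'.1] at h₁
      have h₂ := neg_le_of_abs_le
        (abs_real_inner_le_norm (gradient f (x + t • v) - gradient f x) v)
      have h₃ := mul_le_mul_of_nonneg_right h₁ (norm_nonneg v)
      linarith)
  have h := hmono (Set.left_mem_Icc.2 zero_le_one) (Set.right_mem_Icc.2 zero_le_one) zero_le_one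
  simp only [zero_smul, add_zero, one_smul] at h
  linarith

/-- One Frank–Wolfe averaging step with weight `1 / (n + 1)` for a smooth concave objective. -/
lemma frankWolfe_averaging_step {E : Type*} [NormedAddCommGroup E]
    [InnerProductSpace ℝ E] [CompleteSpace E] {K S : Set E} (hKbdd : Bornology.IsBounded K)
    (hK : Convex ℝ K) (hSK : S ⊆ K) (hScomp : IsCompact S) (hSne : S.Nonempty)
    {f : E → ℝ} {c : ℝ} (hc : 0 ≤ c) (hconc : ConcaveOn ℝ Set.univ f)
    (hf : ∀ x ∈ K, DifferentiableAt ℝ f x)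
    (hgrad : ∀ x ∈ K, ∀ y ∈ K, ‖gradient f x - gradient f y‖ ≤ c * ‖x - y‖)
    {x r : E} (hx : x ∈ K) (hr : r ∈ K) (n : ℕ) :
    ((n + 1 : ℕ) : ℝ) * (sSup (f '' S) - f (x + ((n + 1 : ℕ) : ℝ)⁻¹ • (r - x))) ≤
      n * (sSup (f '' S) - f x) + sSup ((fun s => ⟪gradient f x, s - r⟫) '' S)
        + Metric.diam K ^ 2 * c / (2 * (n + 1 : ℕ)) := by
  have hcont : ContinuousOn f S := fun s hs => (hf s (hSK hs)).continuousAt.continuousWithinAt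
  obtain ⟨s, hs, hsup, -⟩ := hScomp.exists_sSup_image_eq_and_ge hSne hcont
  have hlin : ⟪gradient f x, s - r⟫ ≤ sSup ((fun s => ⟪gradient f x, s - r⟫) '' S) :=
    le_csSup (hScomp.bddAbove_image (by fun_prop)) (Set.mem_image_of_mem _ hs)
  have htan := hconc.le_add_inner_of_hasGradientAt (hf x hx).hasGradientAt s
  have hpos : (0 : ℝ) < ((n + 1 : ℕ) : ℝ) := by positivity
  have hstep : x + ((n + 1 : ℕ) : ℝ)⁻¹ • (r - x) ∈ K :=
    hK.add_smul_sub_mem hx hr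
      ⟨by positivity, inv_le_one_of_one_le₀ (by exact_mod_cast Nat.succ_pos n)⟩
  have hdesc := hK.add_inner_sub_le_of_lipschitz_gradient hf hgrad hx hstep
  rw [inner_smul_right, norm_smul, norm_inv, Real.norm_of_nonneg hpos.le] at hdesc
  have hdiam : ‖r - x‖ ^ 2 ≤ Metric.diam K ^ 2 := by
    gcongr
    rw [← dist_eq_norm]
    exact Metric.dist_le_diam_of_mem hKbdd hr hx
  have hsplit : ⟪gradient f x, s - r⟫ = ⟪gradient f x, s - x⟫ - ⟪gradient f x, r - x⟫ := by
    rw [← inner_sub_right, sub_sub_sub_cancel_right]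
  have hscaled := mul_le_mul_of_nonneg_left hdesc hpos.le
  have hexpand : ((n + 1 : ℕ) : ℝ) * (f x + ((n + 1 : ℕ) : ℝ)⁻¹ * ⟪gradient f x, r - x⟫
      - c / 2 * (((n + 1 : ℕ) : ℝ)⁻¹ * ‖r - x‖) ^ 2) =
      (n + 1 : ℕ) * f x + ⟪gradient f x, r - x⟫ - ‖r - x‖ ^ 2 * c / (2 * (n + 1 : ℕ)) := by
    field_simp
  rw [hexpand] at hscaled
  have hquad : ‖r - x‖ ^ 2 * c / (2 * (n + 1 : ℕ)) ≤
      Metric.diam K ^ 2 * c / (2 * (n + 1 : ℕ)) := by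
    gcongr
  rw [hsup]
  push_cast at *
  linarith

/-- Deterministic core of Lemma C.3: Frank–Wolfe analysis with a time-varying
sequence of smooth concave surrogate objectives. -/
theorem fw_telescoping_time_varying (D : ℕ) (hD : 0 < D)
    (K S : Set (EuclideanSpace ℝ (Fin D)))
    (hKcomp : IsCompact K) (hKconv : Convex ℝ K)
    (hSK : S ⊆ K) (hScomp : IsCompact S) (hSne : S.Nonempty)
    (T : ℕ) (hT : 1 ≤ T)
    (f : ℕ → EuclideanSpace ℝ (Fin D) → ℝ)
    (hconc : ∀ τ ≤ T, ConcaveOn ℝ Set.univ (f τ))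
    (U : Set (EuclideanSpace ℝ (Fin D))) (hUopen : IsOpen U) (hKU : K ⊆ U)
    (hdiff : ∀ τ ≤ T, DifferentiableOn ℝ (f τ) U)
    (C : ℕ → ℝ) (hC : ∀ τ ≤ T, 0 ≤ C τ)
    (hgrad : ∀ τ ≤ T, ∀ z ∈ K, ∀ z' ∈ K,
      ‖gradient (f τ) z - gradient (f τ) z'‖ ≤ C τ * ‖z - z'‖)
    (z ρ : ℕ → EuclideanSpace ℝ (Fin D))
    (hz0 : z 0 ∈ K) (hρ : ∀ τ ∈ Finset.Icc 1 T, ρ τ ∈ K)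
    (hz : ∀ τ ∈ Finset.Icc 1 T,
      z τ = z (τ - 1) + ((τ : ℝ)⁻¹) • (ρ τ - z (τ - 1))) :
    (T : ℝ) * (sSup (f T '' S) - f T (z T)) ≤
      (∑ τ ∈ Finset.Icc 1 T,
        sSup ((fun s => ⟪gradient (f (τ - 1)) (z (τ - 1)), s - ρ τ⟫) '' S))
      + (∑ τ ∈ Finset.Icc 1 T, (τ : ℝ) *
          ((sSup (f τ '' S) - f τ (z τ)) - (sSup (f (τ - 1) '' S) - f (τ - 1) (z τ))))
      + (∑ τ ∈ Finset.Icc 1 T, (Metric.diam K) ^ 2 * C (τ - 1) / (2 * τ)) := by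
  have hdiffAt : ∀ τ ≤ T, ∀ x ∈ K, DifferentiableAt ℝ (f τ) x := fun τ hτ x hx =>
    (hdiff τ hτ).differentiableAt (hUopen.mem_nhds (hKU hx))
  have hzK : ∀ n ≤ T, z n ∈ K := by
    intro n
    induction n with
    | zero => exact fun _ => hz0
    | succ n ih =>
      intro hn
      have hmem : n + 1 ∈ Finset.Icc 1 T := Finset.mem_Icc.2 ⟨by lia, hn⟩
      rw [hz _ hmem]
      exact hKconv.add_smul_sub_mem (ih (by lia)) (hρ _ hmem)
        ⟨by positivity, inv_le_one_of_one_le₀ (by exact_mod_cast Nat.succ_pos n)⟩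
  suffices h : ∀ n ≤ T, (n : ℝ) * (sSup (f n '' S) - f n (z n)) ≤
      (∑ τ ∈ Finset.Icc 1 n,
        sSup ((fun s => ⟪gradient (f (τ - 1)) (z (τ - 1)), s - ρ τ⟫) '' S))
      + (∑ τ ∈ Finset.Icc 1 n, (τ : ℝ) *
          ((sSup (f τ '' S) - f τ (z τ)) - (sSup (f (τ - 1) '' S) - f (τ - 1) (z τ))))
      + (∑ τ ∈ Finset.Icc 1 n, (Metric.diam K) ^ 2 * C (τ - 1) / (2 * τ)) from h T le_rfl
  intro n
  induction n with
  | zero => simp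
  | succ n ih =>
    intro hn
    have hnT : n ≤ T := by lia
    have hmem : n + 1 ∈ Finset.Icc 1 T := Finset.mem_Icc.2 ⟨by lia, hn⟩
    have hstep := frankWolfe_averaging_step hKcomp.isBounded hKconv hSK hScomp hSne (hC n hnT)
      (hconc n hnT) (hdiffAt n hnT) (hgrad n hnT) (hzK n hnT) (hρ _ hmem) n
    have hzn := hz _ hmem
    rw [Nat.add_sub_cancel] at hzn
    rw [← hzn] at hstep
    simp only [Finset.sum_Icc_succ_top (Nat.le_add_left 1 n), Nat.add_sub_cancel]
    linarith [ih hnT]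
end

section
/- Let D be a positive integer, K ⊆ ℝ^D a compact convex set with diameter D_K = sup_{z,z'∈K} ‖z − z'‖₂, S ⊆ K a nonempty compact set, and f : ℝ^D → ℝ a function. Let β₀ > 0, L ≥ 0, M₁ ≥ 0, M₂ ≥ 0, and for each integer τ ≥ 0 let f_τ : ℝ^D → ℝ be concave and differentiable on an open set containing K, with ‖∇f_τ(z)‖₂ ≤ L for all z ∈ K, with gradient (√(τ+1)/β₀)-Lipschitz continuous on K, and such that for every z ∈ K and every τ ≥ 1, |f_τ(z) − f_{τ−1}(z)| ≤ M₁ / (τ·√τ) and |f_τ(z) − f(z)| ≤ M₂ / √τ. Fix an integer T ≥ 1, z₀ ∈ K and ρ₁, …, ρ_T ∈ K, and define the Frank–Wolfe averaging iterates z_τ = z_{τ−1} + (1/τ)(ρ_τ − z_{τ−1}) for τ = 1, …, T. Then sup_{s∈S} f(s) − f(z_T) ≤ (1/T) · ∑_{τ=1}^T sup_{s∈S} ⟨∇f_{τ−1}(z_{τ−1}), s − ρ_τ⟩ + ( D_K²/β₀ + 4·M₁ + 2·M₂ ) / √T. -/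
open scoped RealInnerProductSpace BigOperators

section GradientInequalities

variable {E : Type*} [NormedAddCommGroup E] [InnerProductSpace ℝ E] [CompleteSpace E]

/-- The restriction of a function to a line has derivative the inner product of the gradient
with the direction. -/
theorem HasGradientAt.hasDerivAt_lineMap {F : E → ℝ} {g x y : E} {t : ℝ}
    (h : HasGradientAt F g (AffineMap.lineMap x y t)) :
    HasDerivAt (fun u : ℝ => F (AffineMap.lineMap x y u)) ⟪g, y - x⟫ t := by
  simpa [Function.comp_def] using h.hasFDerivAt.comp_hasDerivAt t AffineMap.hasDerivAt_lineMap

/-- First-order upper bound for a concave function. -/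
theorem ConcaveOn.sub_le_inner_of_hasGradientAt {F : E → ℝ} {g x : E}
    (hF : ConcaveOn ℝ Set.univ F) (h : HasGradientAt F g x) (y : E) :
    F y - F x ≤ ⟪g, y - x⟫ := by
  have hconc : ConcaveOn ℝ Set.univ (fun u : ℝ => F (AffineMap.lineMap x y u)) :=
    hF.comp_affineMap (AffineMap.lineMap x y : ℝ →ᵃ[ℝ] E)
  have hderiv : HasDerivAt (fun u : ℝ => F (AffineMap.lineMap x y u)) ⟪g, y - x⟫ 0 :=
    HasGradientAt.hasDerivAt_lineMap (by simpa using h)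
  simpa [slope_def_field] using hconc.slope_le_of_hasDerivAt (Set.mem_univ 0) (Set.mem_univ 1)
    one_pos hderiv

/-- Quadratic lower bound for a function whose gradient is Lipschitz on a convex set. -/
theorem Convex.add_inner_sub_le_of_gradient_lipschitz {F : E → ℝ} {G : E → E} {K : Set E}
    {l : ℝ} (hK : Convex ℝ K) (hG : ∀ x ∈ K, HasGradientAt F (G x) x)
    (hlip : ∀ x ∈ K, ∀ y ∈ K, ‖G x - G y‖ ≤ l * ‖x - y‖) {x y : E} (hx : x ∈ K) (hy : y ∈ K) :
    F x + ⟪G x, y - x⟫ - l / 2 * ‖y - x‖ ^ 2 ≤ F y := by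
  have hmem : ∀ t ∈ Set.Icc (0 : ℝ) 1, AffineMap.lineMap x y t ∈ K := fun t ht =>
    hK.lineMap_mem hx hy ht
  have hderiv : ∀ t ∈ Set.Icc (0 : ℝ) 1, HasDerivAt
      (fun u : ℝ => F (AffineMap.lineMap x y u) - u * ⟪G x, y - x⟫ + l / 2 * ‖y - x‖ ^ 2 * u ^ 2)
      (⟪G (AffineMap.lineMap x y t), y - x⟫ - ⟪G x, y - x⟫ + l * ‖y - x‖ ^ 2 * t) t := by
    intro t ht
    have h := ((HasGradientAt.hasDerivAt_lineMap (hG _ (hmem t ht))).sub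
      ((hasDerivAt_id t).mul_const ⟪G x, y - x⟫)).add
      ((hasDerivAt_pow 2 t).const_mul (l / 2 * ‖y - x‖ ^ 2))
    refine h.congr_deriv ?_
    push_cast
    ring
  have hmono := monotoneOn_of_hasDerivWithinAt_nonneg (convex_Icc (0 : ℝ) 1)
    (fun t ht => (hderiv t ht).continuousAt.continuousWithinAt)
    (fun t ht => (hderiv t (interior_subset ht)).hasDerivWithinAt) (fun t ht => by
      have ht' := interior_subset ht
      have hlip' := hlip x hx _ (hmem t ht')
      have hnorm : ‖x - AffineMap.lineMap x y t‖ = t * ‖y - x‖ := by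
        rw [← dist_eq_norm, dist_left_lineMap, Real.norm_of_nonneg ht'.1, dist_comm x y,
          dist_eq_norm]
      rw [hnorm] at hlip'
      have hinner := real_inner_le_norm (G x - G (AffineMap.lineMap x y t)) (y - x)
      rw [inner_sub_left] at hinner
      have := mul_le_mul_of_nonneg_right hlip' (norm_nonneg (y - x))
      nlinarith)
  have := hmono (Set.left_mem_Icc.2 zero_le_one) (Set.right_mem_Icc.2 zero_le_one) zero_le_one
  simp only [AffineMap.lineMap_apply_zero, AffineMap.lineMap_apply_one] at this
  linarith

end GradientInequalities

/-- One step of the telescoping bound for `∑ 1 / √k`. -/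
theorem Real.inv_sqrt_add_one_add_two_mul_sqrt_le {t : ℝ} (ht : 0 ≤ t) :
    1 / √(t + 1) + 2 * √t ≤ 2 * √(t + 1) := by
  have hb : 0 < √(t + 1) := Real.sqrt_pos.2 (by linarith)
  have hb2 := Real.sq_sqrt (show 0 ≤ t + 1 by linarith)
  have ha2 := Real.sq_sqrt ht
  have h : 1 / √(t + 1) ≤ 2 * √(t + 1) - 2 * √t := by
    rw [div_le_iff₀ hb]
    nlinarith [sq_nonneg (√(t + 1) - √t)]
  linarith

/-- Deterministic core of Theorem C.2: Frank–Wolfe convergence for a possibly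
nonsmooth objective `f` approached through smooth approximations `fapprox τ`. -/
theorem fw_convergence_smoothing (D : ℕ) (hD : 0 < D)
    (K S : Set (EuclideanSpace ℝ (Fin D)))
    (hKcomp : IsCompact K) (hKconv : Convex ℝ K)
    (hSK : S ⊆ K) (hScomp : IsCompact S) (hSne : S.Nonempty)
    (f : EuclideanSpace ℝ (Fin D) → ℝ)
    (β₀ L M₁ M₂ : ℝ) (hβ₀ : 0 < β₀) (hL : 0 ≤ L) (hM₁ : 0 ≤ M₁) (hM₂ : 0 ≤ M₂)
    (fapprox : ℕ → EuclideanSpace ℝ (Fin D) → ℝ)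
    (U : Set (EuclideanSpace ℝ (Fin D))) (hUopen : IsOpen U) (hKU : K ⊆ U)
    (hconc : ∀ τ : ℕ, ConcaveOn ℝ Set.univ (fapprox τ))
    (hdiff : ∀ τ : ℕ, DifferentiableOn ℝ (fapprox τ) U)
    (hgradbound : ∀ τ : ℕ, ∀ z ∈ K, ‖gradient (fapprox τ) z‖ ≤ L)
    (hgradlip : ∀ τ : ℕ, ∀ z ∈ K, ∀ z' ∈ K,
      ‖gradient (fapprox τ) z - gradient (fapprox τ) z'‖ ≤
        (Real.sqrt (τ + 1) / β₀) * ‖z - z'‖)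
    (hclose₁ : ∀ τ : ℕ, 1 ≤ τ → ∀ z ∈ K,
      |fapprox τ z - fapprox (τ - 1) z| ≤ M₁ / (τ * Real.sqrt τ))
    (hclose₂ : ∀ τ : ℕ, 1 ≤ τ → ∀ z ∈ K,
      |fapprox τ z - f z| ≤ M₂ / Real.sqrt τ)
    (T : ℕ) (hT : 1 ≤ T)
    (z ρ : ℕ → EuclideanSpace ℝ (Fin D))
    (hz0 : z 0 ∈ K) (hρ : ∀ τ ∈ Finset.Icc 1 T, ρ τ ∈ K)
    (hz : ∀ τ ∈ Finset.Icc 1 T,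
      z τ = z (τ - 1) + ((τ : ℝ)⁻¹) • (ρ τ - z (τ - 1))) :
    sSup (f '' S) - f (z T) ≤
      (T : ℝ)⁻¹ * (∑ τ ∈ Finset.Icc 1 T,
        sSup ((fun s => ⟪gradient (fapprox (τ - 1)) (z (τ - 1)), s - ρ τ⟫) '' S))
      + ((Metric.diam K) ^ 2 / β₀ + 4 * M₁ + 2 * M₂) / Real.sqrt T := by
  have hgrad : ∀ τ, ∀ x ∈ K, HasGradientAt (fapprox τ) (gradient (fapprox τ) x) x :=
    fun τ x hx => (hdiff τ).hasGradientAt (hUopen.mem_nhds (hKU hx))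
  have hzK : ∀ τ ≤ T, z τ ∈ K := by
    intro τ
    induction τ with
    | zero => exact fun _ => hz0
    | succ t ih =>
      intro ht
      have hmem : t + 1 ∈ Finset.Icc 1 T := Finset.mem_Icc.2 ⟨by omega, ht⟩
      rw [hz _ hmem]
      refine hKconv.add_smul_sub_mem (ih (by omega)) (hρ _ hmem) ⟨by positivity, ?_⟩
      exact inv_le_one_of_one_le₀ (by push_cast; linarith [t.cast_nonneg (α := ℝ)])
  set g : ℕ → ℝ := fun τ =>
    sSup ((fun s => ⟪gradient (fapprox (τ - 1)) (z (τ - 1)), s - ρ τ⟫) '' S)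
  have hle_g : ∀ τ, ∀ s ∈ S,
      ⟪gradient (fapprox (τ - 1)) (z (τ - 1)), s - ρ τ⟫ ≤ g τ := fun τ s hs =>
    le_csSup (hScomp.image (by fun_prop)).bddAbove (Set.mem_image_of_mem _ hs)
  set C : ℝ := Metric.diam K ^ 2 / (2 * β₀) + 2 * M₁ with hC
  have hC0 : 0 ≤ C := by positivity
  have hstep : ∀ s ∈ S, ∀ t : ℕ, t + 1 ≤ T →
      ((t : ℝ) + 1) * (fapprox (t + 1) s - fapprox (t + 1) (z (t + 1))) ≤
        t * (fapprox t s - fapprox t (z t)) + g (t + 1) + C / √(t + 1) := by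
    intro s hs t ht
    have hmem : t + 1 ∈ Finset.Icc 1 T := Finset.mem_Icc.2 ⟨by omega, ht⟩
    have hzt := hzK t (by omega)
    have hzt' := hzK (t + 1) ht
    have hn : (0 : ℝ) < t + 1 := by positivity
    have hb : 0 < √((t : ℝ) + 1) := Real.sqrt_pos.2 hn
    have hb2 := Real.sq_sqrt hn.le
    have hs₁ := (abs_le.1 (hclose₁ (t + 1) (by omega) s (hSK hs))).2
    have hz₁ := (abs_le.1 (hclose₁ (t + 1) (by omega) _ hzt')).1
    have hgs := hle_g (t + 1) s hs
    have hdesc := hKconv.add_inner_sub_le_of_gradient_lipschitz (hgrad t) (hgradlip t) hzt hzt'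
    have hup := (hconc t).sub_le_inner_of_hasGradientAt (hgrad t _ hzt) s
    have hzstep : z (t + 1) - z t = ((t : ℝ) + 1)⁻¹ • (ρ (t + 1) - z t) := by
      rw [hz _ hmem]
      push_cast
      simp
    have hdiam : ‖ρ (t + 1) - z t‖ ^ 2 ≤ Metric.diam K ^ 2 := by
      rw [← dist_eq_norm]
      exact pow_le_pow_left₀ dist_nonneg
        (Metric.dist_le_diam_of_mem hKcomp.isBounded (hρ _ hmem) hzt) 2
    rw [hzstep, real_inner_smul_right, norm_smul, Real.norm_of_nonneg (by positivity)] at hdesc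
    have hsplit : ⟪gradient (fapprox t) (z t), s - z t⟫ =
        ⟪gradient (fapprox t) (z t), s - ρ (t + 1)⟫ +
          ⟪gradient (fapprox t) (z t), ρ (t + 1) - z t⟫ := by
      rw [← inner_add_right]
      congr 1
      abel
    simp only [Nat.add_sub_cancel] at hs₁ hz₁ hgs
    push_cast at hs₁ hz₁
    set b := √((t : ℝ) + 1)
    set p := ⟪gradient (fapprox t) (z t), ρ (t + 1) - z t⟫
    have hquad : ((t : ℝ) + 1) * (b / β₀ / 2 * (((t : ℝ) + 1)⁻¹ * ‖ρ (t + 1) - z t‖) ^ 2) ≤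
        Metric.diam K ^ 2 / (2 * β₀) / b := by
      rw [← hb2]
      calc b ^ 2 * (b / β₀ / 2 * ((b ^ 2)⁻¹ * ‖ρ (t + 1) - z t‖) ^ 2)
          = ‖ρ (t + 1) - z t‖ ^ 2 / (2 * β₀) / b := by field_simp
        _ ≤ _ := by gcongr
    have hM : ((t : ℝ) + 1) * (M₁ / (((t : ℝ) + 1) * b)) = M₁ / b := by field_simp
    have hp : ((t : ℝ) + 1) * (((t : ℝ) + 1)⁻¹ * p) = p := by field_simp
    have hCb : C / b = Metric.diam K ^ 2 / (2 * β₀) / b + 2 * (M₁ / b) := by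
      rw [hC]
      ring
    have hs₂ := mul_le_mul_of_nonneg_left hs₁ hn.le
    have hz₂ := mul_le_mul_of_nonneg_left hz₁ hn.le
    have hd₂ := mul_le_mul_of_nonneg_left hdesc hn.le
    rw [hCb]
    linarith
  have hsum : ∀ s ∈ S, ∀ t ≤ T, (t : ℝ) * (fapprox t s - fapprox t (z t)) ≤
      ∑ τ ∈ Finset.Icc 1 t, g τ + 2 * C * √t := by
    intro s hs t
    induction t with
    | zero => simp
    | succ t ih =>
      intro ht
      have h₁ := ih (by omega)
      have h₂ := hstep s hs t ht
      have h₃ := mul_le_mul_of_nonneg_left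
        (Real.inv_sqrt_add_one_add_two_mul_sqrt_le t.cast_nonneg) hC0
      rw [mul_add, mul_one_div] at h₃
      rw [Finset.sum_Icc_succ_top (by omega)]
      push_cast
      linarith
  have hT0 : (0 : ℝ) < T := by exact_mod_cast hT
  have hb : 0 < √(T : ℝ) := Real.sqrt_pos.2 hT0
  have hb2 := Real.sq_sqrt hT0.le
  rw [sub_le_iff_le_add]
  refine csSup_le (hSne.image f) ?_
  rintro _ ⟨s, hs, rfl⟩
  have hs₂ := (abs_le.1 (hclose₂ T hT s (hSK hs))).1
  have hz₂ := (abs_le.1 (hclose₂ T hT _ (hzK T le_rfl))).2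
  have hmain := mul_le_mul_of_nonneg_left (hsum s hs T le_rfl) (inv_nonneg.2 hT0.le)
  rw [inv_mul_cancel_left₀ hT0.ne', mul_add] at hmain
  have hrate : (T : ℝ)⁻¹ * (2 * C * √T) + 2 * (M₂ / √T) =
      (Metric.diam K ^ 2 / β₀ + 4 * M₁ + 2 * M₂) / √T := by
    have hinv : (T : ℝ)⁻¹ * √T = 1 / √T := by
      nth_rewrite 1 [← hb2]
      field_simp
    calc (T : ℝ)⁻¹ * (2 * C * √T) + 2 * (M₂ / √T)
        = 2 * C * ((T : ℝ)⁻¹ * √T) + 2 * (M₂ / √T) := by ring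
      _ = _ := by
        rw [hinv, hC]
        field_simp
        ring
  linarith
end

section
/- Let T be a positive integer, w₁, …, w_T nonnegative real numbers, and R : {1, …, T} → ℝ a function with R(τ) > 0 for all τ and ∑_{τ'=1}^τ w_{τ'} ≤ R(τ) for every τ ∈ {1, …, T}. Let γ₀ > 0 and set γ_τ = γ₀ · √( τ / R(τ) ) for each τ. Then ∑_{τ=1}^T γ_τ · w_τ ≤ 2 · γ₀ · √( T · R(T) ). -/
open scoped BigOperators

theorem div_sqrt_le_two_mul_sqrt_sub {s w r : ℝ} (hs : 0 ≤ s) (hw : 0 ≤ w) (hr : 0 < r)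
    (hle : s + w ≤ r) : w / √r ≤ 2 * (√(s + w) - √s) := by
  have hmono : √s ≤ √(s + w) := Real.sqrt_le_sqrt (by linarith)
  have hle' : √(s + w) ≤ √r := Real.sqrt_le_sqrt hle
  rw [div_le_iff₀ (Real.sqrt_pos.2 hr)]
  nlinarith [Real.sq_sqrt hs, Real.sq_sqrt (add_nonneg hs hw)]

theorem sum_div_sqrt_le_two_mul_sqrt_sum (T : ℕ) (w R : ℕ → ℝ)
    (hw : ∀ τ ∈ Finset.Icc 1 T, 0 ≤ w τ) (hRpos : ∀ τ ∈ Finset.Icc 1 T, 0 < R τ)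
    (hRbound : ∀ τ ∈ Finset.Icc 1 T, ∑ i ∈ Finset.Icc 1 τ, w i ≤ R τ) :
    ∑ τ ∈ Finset.Icc 1 T, w τ / √(R τ) ≤ 2 * √(∑ τ ∈ Finset.Icc 1 T, w τ) := by
  induction T with
  | zero => simp
  | succ n ih =>
    have hsub : Finset.Icc 1 n ⊆ Finset.Icc 1 (n + 1) :=
      Finset.Icc_subset_Icc_right n.le_succ
    have hmem : n + 1 ∈ Finset.Icc 1 (n + 1) := by simp
    have hprev := ih (fun τ h => hw τ (hsub h)) (fun τ h => hRpos τ (hsub h))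
      (fun τ h => hRbound τ (hsub h))
    have hbound := hRbound _ hmem
    rw [Finset.sum_Icc_succ_top (by omega)] at hbound
    rw [Finset.sum_Icc_succ_top (by omega), Finset.sum_Icc_succ_top (by omega)]
    have hstep := div_sqrt_le_two_mul_sqrt_sub
      (Finset.sum_nonneg fun τ h => hw τ (hsub h)) (hw _ hmem) (hRpos _ hmem) hbound
    linarith

/-- Deterministic content of Lemma F.4: bound on the cumulative
exploration-weighted error with time-varying exploration parameters. -/
theorem sum_gamma_weighted_le (T : ℕ) (hT : 1 ≤ T) (w : ℕ → ℝ)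
    (hw : ∀ τ ∈ Finset.Icc 1 T, 0 ≤ w τ)
    (R : ℕ → ℝ)
    (hRpos : ∀ τ ∈ Finset.Icc 1 T, 0 < R τ)
    (hRbound : ∀ τ ∈ Finset.Icc 1 T, (∑ τ' ∈ Finset.Icc 1 τ, w τ') ≤ R τ)
    (γ₀ : ℝ) (hγ₀ : 0 < γ₀) (γ : ℕ → ℝ)
    (hγ : ∀ τ ∈ Finset.Icc 1 T, γ τ = γ₀ * Real.sqrt (τ / R τ)) :
    ∑ τ ∈ Finset.Icc 1 T, γ τ * w τ ≤ 2 * γ₀ * Real.sqrt (T * R T) := by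
  have hterm : ∀ τ ∈ Finset.Icc 1 T, γ τ * w τ ≤ γ₀ * √T * (w τ / √(R τ)) := by
    intro τ hτ
    have hw' : 0 ≤ w τ / √(R τ) := div_nonneg (hw τ hτ) (Real.sqrt_nonneg _)
    have hτT : (τ : ℝ) ≤ T := by exact_mod_cast (Finset.mem_Icc.1 hτ).2
    calc γ τ * w τ = γ₀ * √τ * (w τ / √(R τ)) := by
          rw [hγ τ hτ, Real.sqrt_div (Nat.cast_nonneg τ)]
          ring
      _ ≤ γ₀ * √T * (w τ / √(R τ)) := by gcongr
  calc ∑ τ ∈ Finset.Icc 1 T, γ τ * w τ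
      ≤ ∑ τ ∈ Finset.Icc 1 T, γ₀ * √T * (w τ / √(R τ)) := Finset.sum_le_sum hterm
    _ = γ₀ * √T * ∑ τ ∈ Finset.Icc 1 T, w τ / √(R τ) := by rw [Finset.mul_sum]
    _ ≤ γ₀ * √T * (2 * √(∑ τ ∈ Finset.Icc 1 T, w τ)) := by
        gcongr
        exact sum_div_sqrt_le_two_mul_sqrt_sum T w R hw hRpos hRbound
    _ ≤ γ₀ * √T * (2 * √(R T)) := by
        gcongr
        exact hRbound T (Finset.mem_Icc.2 ⟨hT, le_rfl⟩)
    _ = 2 * γ₀ * √(T * R T) := by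
        rw [Real.sqrt_mul (Nat.cast_nonneg T)]
        ring
end

section
/- Let D be a positive integer, L ≥ 0, and let f : ℝ^D → ℝ be concave and L-Lipschitz continuous with respect to ‖·‖₂. Let β ≥ β' > 0. Then for every z ∈ ℝ^D the suprema defining M_β f(z) and M_{β'} f(z) are attained, and 0 ≤ M_β f(z) − M_{β'} f(z) ≤ (L²·β/2) · ( β/β' − 1 ). -/
section MoreauEnvelope

variable {E : Type*} [NormedAddCommGroup E] {f : E → ℝ} {L β : ℝ} {z p : E}

/-- The supremum defining the Moreau envelope of a Lipschitz function is attained. -/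
theorem exists_forall_sub_sq_norm_le [ProperSpace E]
    (hL : 0 ≤ L) (hf : ∀ x y, |f x - f y| ≤ L * ‖x - y‖) (hβ : 0 < β) (z : E) :
    ∃ p, ∀ y, f y - ‖y - z‖ ^ 2 / (2 * β) ≤ f p - ‖p - z‖ ^ 2 / (2 * β) := by
  have hc : Continuous f :=
    (LipschitzWith.of_dist_le_mul (K := ⟨L, hL⟩) fun x y => by
      rw [Real.dist_eq, dist_eq_norm]
      exact hf x y).continuous
  have hg : Continuous fun y => f y - ‖y - z‖ ^ 2 / (2 * β) := by fun_prop
  have hz : z ∈ Metric.closedBall z (2 * L * β) := Metric.mem_closedBall_self (by positivity)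
  obtain ⟨p, -, hp⟩ := (isCompact_closedBall z (2 * L * β)).exists_isMaxOn ⟨z, hz⟩ hg.continuousOn
  refine ⟨p, fun y => ?_⟩
  by_cases hy : y ∈ Metric.closedBall z (2 * L * β)
  · exact hp hy
  · refine le_trans ?_ (hp hz)
    rw [Metric.mem_closedBall, dist_eq_norm, not_le] at hy
    have hfy := (le_abs_self _).trans (hf y z)
    have hq : L * ‖y - z‖ ≤ ‖y - z‖ ^ 2 / (2 * β) := by
      rw [le_div_iff₀ (by positivity)]
      nlinarith [norm_nonneg (y - z)]
    simp only [sub_self, norm_zero]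
    norm_num
    linarith

/-- A maximizer in the Moreau envelope of an `L`-Lipschitz function at `z` lies within `L * β`
of `z`. -/
theorem norm_sub_le_of_forall_sub_sq_norm_le [NormedSpace ℝ E]
    (hL : 0 ≤ L) (hf : ∀ x y, |f x - f y| ≤ L * ‖x - y‖) (hβ : 0 < β)
    (hp : ∀ y, f y - ‖y - z‖ ^ 2 / (2 * β) ≤ f p - ‖p - z‖ ^ 2 / (2 * β)) :
    ‖p - z‖ ≤ L * β := by
  by_contra! h
  have hLβ : 0 ≤ L * β := by positivity
  have hd : 0 < ‖p - z‖ := hLβ.trans_lt h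
  set c := L * β / ‖p - z‖ with hc
  have hc1 : c ≤ 1 := (div_le_one hd).2 h.le
  have hcd : c * ‖p - z‖ = L * β := div_mul_cancel₀ _ hd.ne'
  have hyz : ‖z + c • (p - z) - z‖ = L * β := by
    rw [add_sub_cancel_left, norm_smul, Real.norm_of_nonneg (by positivity), hcd]
  have hpy : ‖p - (z + c • (p - z))‖ = ‖p - z‖ - L * β := by
    rw [show p - (z + c • (p - z)) = (1 - c) • (p - z) by module, norm_smul,
      Real.norm_of_nonneg (sub_nonneg.2 hc1), sub_mul, hcd, one_mul]
  have hmax := hp (z + c • (p - z))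
  have hlip := (le_abs_self _).trans (hf p (z + c • (p - z)))
  rw [hyz] at hmax
  rw [hpy] at hlip
  have hquot : (‖p - z‖ ^ 2 - (L * β) ^ 2) / (2 * β) ≤ L * (‖p - z‖ - L * β) := by
    rw [sub_div]
    linarith
  rw [div_le_iff₀ (by positivity)] at hquot
  nlinarith [mul_pos (sub_pos.2 h) (sub_pos.2 h)]

end MoreauEnvelope


/-- Comparison of Moreau envelopes with different smoothing parameters
(Lemma E.1, second bullet), including attainment of the suprema. -/
theorem moreau_envelope_compare (D : ℕ) (hD : 0 < D) (L : ℝ) (hL : 0 ≤ L)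
    (f : EuclideanSpace ℝ (Fin D) → ℝ)
    (hconc : ConcaveOn ℝ Set.univ f)
    (hf : ∀ x y, |f x - f y| ≤ L * ‖x - y‖)
    (β β' : ℝ) (hβ' : 0 < β') (hββ' : β' ≤ β) :
    ∀ z : EuclideanSpace ℝ (Fin D),
      (∃ p, f p - ‖p - z‖ ^ 2 / (2 * β) =
        sSup (Set.range fun y => f y - ‖y - z‖ ^ 2 / (2 * β))) ∧
      (∃ p', f p' - ‖p' - z‖ ^ 2 / (2 * β') =
        sSup (Set.range fun y => f y - ‖y - z‖ ^ 2 / (2 * β'))) ∧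
      0 ≤ sSup (Set.range fun y => f y - ‖y - z‖ ^ 2 / (2 * β)) -
        sSup (Set.range fun y => f y - ‖y - z‖ ^ 2 / (2 * β')) ∧
      sSup (Set.range fun y => f y - ‖y - z‖ ^ 2 / (2 * β)) -
        sSup (Set.range fun y => f y - ‖y - z‖ ^ 2 / (2 * β')) ≤
        (L ^ 2 * β / 2) * (β / β' - 1) := by
  intro z
  have hβ : 0 < β := hβ'.trans_le hββ'
  obtain ⟨p, hp⟩ := exists_forall_sub_sq_norm_le hL hf hβ z
  obtain ⟨q, hq⟩ := exists_forall_sub_sq_norm_le hL hf hβ' z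
  have hsp := IsGreatest.csSup_eq (s := Set.range fun y => f y - ‖y - z‖ ^ 2 / (2 * β))
    ⟨⟨p, rfl⟩, Set.forall_mem_range.2 hp⟩
  have hsq := IsGreatest.csSup_eq (s := Set.range fun y => f y - ‖y - z‖ ^ 2 / (2 * β'))
    ⟨⟨q, rfl⟩, Set.forall_mem_range.2 hq⟩
  refine ⟨⟨p, hsp.symm⟩, ⟨q, hsq.symm⟩, ?_, ?_⟩ <;> rw [hsp, hsq]
  · have hmono : ‖q - z‖ ^ 2 / (2 * β) ≤ ‖q - z‖ ^ 2 / (2 * β') := by gcongr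
    linarith [hp q]
  · have hd := norm_sub_le_of_forall_sub_sq_norm_le hL hf hβ hp
    calc f p - ‖p - z‖ ^ 2 / (2 * β) - (f q - ‖q - z‖ ^ 2 / (2 * β'))
        ≤ ‖p - z‖ ^ 2 / (2 * β') - ‖p - z‖ ^ 2 / (2 * β) := by linarith [hq p]
      _ = ‖p - z‖ ^ 2 * ((β / β' - 1) / (2 * β)) := by field_simp
      _ ≤ (L * β) ^ 2 * ((β / β' - 1) / (2 * β)) := by
        have : 0 ≤ β / β' - 1 := sub_nonneg.2 ((one_le_div hβ').2 hββ')
        gcongr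
      _ = (L ^ 2 * β / 2) * (β / β' - 1) := by field_simp
end

section
/- Let K be a positive integer, γ > 0, and ŷ, y : {1, …, K} → ℝ. Let b ∈ argmax_{a} ŷ(a). Define p : {1, …, K} → ℝ by p(a) = 1 / ( K + γ·(ŷ(b) − ŷ(a)) ) for a ≠ b, and p(b) = 1 − ∑_{a ≠ b} p(a). Then p is a probability distribution on {1, …, K} (i.e. p(a) ≥ 0 for all a and ∑_a p(a) = 1), and ∑_{a=1}^K p(a) · ( max_{a'} y(a') − y(a) ) ≤ 2K/γ + (γ/4) · ∑_{a=1}^K p(a) · ( ŷ(a) − y(a) )². -/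
open scoped BigOperators

/-- Young's inequality `x ≤ 1 / γ + (γ / 4) x²`, weighted by `q`. -/
lemma mul_sub_quadratic_le {γ q : ℝ} (hγ : 0 < γ) (hq : 0 ≤ q) (x : ℝ) :
    q * x ≤ q / γ + γ / 4 * (q * x ^ 2) := by
  have h : q / γ + γ / 4 * (q * x ^ 2) - q * x = q * (γ * x / 2 - 1) ^ 2 / γ := by
    field_simp
    ring
  have : 0 ≤ q * (γ * x / 2 - 1) ^ 2 / γ := by positivity
  linarith

/-- The variant of `mul_sub_quadratic_le` with an extra linear term `-x`, which costs
at most `1 / (γ q)`. -/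
lemma mul_sub_sub_quadratic_le {γ q : ℝ} (hγ : 0 < γ) (hq : 0 < q) (x : ℝ) :
    q * x - x ≤ q / γ + γ / 4 * (q * x ^ 2) + q⁻¹ / γ := by
  have h : q / γ + γ / 4 * (q * x ^ 2) + q⁻¹ / γ - (q * x - x) =
      (γ * q * x / 2 + (1 - q)) ^ 2 / (γ * q) + 2 / γ := by
    field_simp
    ring
  have : 0 ≤ (γ * q * x / 2 + (1 - q)) ^ 2 / (γ * q) + 2 / γ := by positivity
  linarith

/-- For a fully supported distribution `p`, the mean of `x` minus its value at any `s` is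
controlled by the mean of `x²`, up to the inverse probability of `s`. -/
lemma estimation_regret_le {ι : Type*} [Fintype ι] {γ : ℝ} (hγ : 0 < γ)
    {p : ι → ℝ} (hp : ∀ a, 0 < p a) (hsum : ∑ a, p a = 1) (x : ι → ℝ) (s : ι) :
    ∑ a, p a * x a - x s ≤ 1 / γ + γ / 4 * ∑ a, p a * x a ^ 2 + (p s)⁻¹ / γ := by
  classical
  have h : ∑ a, (p a * x a - if a = s then x s else 0) ≤
      ∑ a, (p a / γ + γ / 4 * (p a * x a ^ 2) + if a = s then (p s)⁻¹ / γ else 0) := by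
    refine Finset.sum_le_sum fun a _ => ?_
    split_ifs with has
    · subst has
      exact mul_sub_sub_quadratic_le hγ (hp a) (x a)
    · simpa using mul_sub_quadratic_le hγ (hp a).le (x a)
  simpa [Finset.sum_sub_distrib, Finset.sum_add_distrib, ← Finset.mul_sum, ← Finset.sum_div,
    hsum] using h

/-- Lemma F.2 (inverse-gap-weighting inequality of SquareCB): the exploration
distribution `p` is a probability distribution and its instantaneous regret is
controlled by the squared prediction error. -/
theorem squarecb_inverse_gap_weighting (K : ℕ) (hK : 0 < K) (γ : ℝ)
    (hγ : 0 < γ) (yhat y : Fin K → ℝ) (b : Fin K)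
    (hb : ∀ a, yhat a ≤ yhat b)
    (p : Fin K → ℝ)
    (hp_ne : ∀ a, a ≠ b → p a = 1 / (K + γ * (yhat b - yhat a)))
    (hp_b : p b = 1 - ∑ a ∈ Finset.univ.erase b, p a) :
    (∀ a, 0 ≤ p a) ∧ (∑ a, p a = 1) ∧
    ∑ a, p a * ((Finset.univ.sup' (Finset.univ_nonempty_iff.mpr ⟨b⟩) y) - y a) ≤
      2 * K / γ + (γ / 4) * ∑ a, p a * (yhat a - y a) ^ 2 := by
  have hK' : (0 : ℝ) < K := by exact_mod_cast hK
  have hgap (a) : 0 ≤ γ * (yhat b - yhat a) := mul_nonneg hγ.le (sub_nonneg.2 (hb a))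
  have hcard : ((Finset.univ.erase b).card : ℝ) = K - 1 := by
    rw [Finset.card_erase_of_mem (Finset.mem_univ b), Finset.card_univ, Fintype.card_fin,
      Nat.cast_pred hK]
  have hpb : 1 / (K : ℝ) ≤ p b := by
    have h : ∑ a ∈ Finset.univ.erase b, p a ≤ (Finset.univ.erase b).card • (1 / (K : ℝ)) := by
      refine Finset.sum_le_card_nsmul _ _ _ fun a ha => ?_
      rw [hp_ne a (Finset.ne_of_mem_erase ha)]
      exact one_div_le_one_div_of_le hK' (le_add_of_nonneg_right (hgap a))
    rw [nsmul_eq_mul, hcard, sub_mul, mul_one_div_cancel hK'.ne'] at h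
    linarith
  have hp_lower (a) : 1 / (K + γ * (yhat b - yhat a)) ≤ p a := by
    by_cases hab : a = b
    · subst hab
      simpa using hpb
    · exact (hp_ne a hab).ge
  have hpos (a) : 0 < p a :=
    (one_div_pos.2 (add_pos_of_pos_of_nonneg hK' (hgap a))).trans_le (hp_lower a)
  have hsum : ∑ a, p a = 1 := by
    rw [← Finset.add_sum_erase _ _ (Finset.mem_univ b), hp_b]
    ring
  refine ⟨fun a => (hpos a).le, hsum, ?_⟩
  obtain ⟨s, -, hs⟩ := Finset.exists_mem_eq_sup' (Finset.univ_nonempty_iff.mpr ⟨b⟩) y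
  rw [hs]
  have hgreedy : ∑ a, p a * (yhat b - yhat a) ≤ (K - 1) / γ := by
    rw [← Finset.add_sum_erase _ _ (Finset.mem_univ b), sub_self, mul_zero, zero_add]
    have h : ∑ a ∈ Finset.univ.erase b, p a * (yhat b - yhat a) ≤
        (Finset.univ.erase b).card • (1 / γ) := by
      refine Finset.sum_le_card_nsmul _ _ _ fun a ha => ?_
      rw [hp_ne a (Finset.ne_of_mem_erase ha), one_div_mul_eq_div,
        div_le_div_iff₀ (add_pos_of_pos_of_nonneg hK' (hgap a)) hγ]
      linarith
    rwa [nsmul_eq_mul, hcard, mul_one_div] at h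
  have hinv : (p s)⁻¹ / γ ≤ K / γ + (yhat b - yhat s) := by
    have h : (p s)⁻¹ ≤ K + γ * (yhat b - yhat s) := by
      rw [← one_div]
      exact (one_div_le (hpos s) (add_pos_of_pos_of_nonneg hK' (hgap s))).2 (hp_lower s)
    rw [div_le_iff₀ hγ, add_mul, div_mul_cancel₀ _ hγ.ne']
    linarith
  have hest := estimation_regret_le hγ hpos hsum (fun a => yhat a - y a) s
  have hdecomp : ∑ a, p a * (y s - y a) =
      ∑ a, p a * (yhat b - yhat a) + ∑ a, p a * (yhat a - y a) + (y s - yhat b) := by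
    rw [← one_mul (y s - yhat b), ← hsum, Finset.sum_mul, ← Finset.sum_add_distrib,
      ← Finset.sum_add_distrib]
    exact Finset.sum_congr rfl fun a _ => by ring
  have hK2 : 2 * (K : ℝ) / γ = (K - 1) / γ + 1 / γ + K / γ := by ring
  linarith
end

section
/- Let d, m, T be positive integers and k̄ a positive integer with k̄ ≤ m. Let D_X > 0 and λ ≥ D_X²·k̄. For each t ∈ {1, …, T} and i ∈ {1, …, m} let x_{t,i} ∈ ℝ^d with ‖x_{t,i}‖₂ ≤ D_X and e_{t,i} ∈ {0,1}, with ∑_{i=1}^m e_{t,i} ≤ k̄ for every t. Define V₀ = λ·I_d and V_t = V_{t−1} + ∑_{i=1}^m e_{t,i}·x_{t,i}·x_{t,i}ᵀ for t = 1, …, T (each V_t is positive definite, hence invertible). Then ∑_{t=1}^T ∑_{i=1}^m e_{t,i} · x_{t,i}ᵀ V_{t−1}^{−1} x_{t,i} ≤ 2·ln( det(V_T) / det(V₀) ) ≤ 2·d·ln( 1 + T·D_X²·k̄ / (λ·d) ). -/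
open scoped BigOperators
open Matrix

open Matrix Finset in
/-- For a positive semidefinite matrix `M`, expanding `det (1 + M)` over eigenvalues dominates
`1 + trace M`. -/
theorem one_add_trace_le_det_one_add {n : Type*} [Fintype n] [DecidableEq n]
    {M : Matrix n n ℝ} (hM : M.PosSemidef) : 1 + M.trace ≤ (1 + M).det := by
  have hprod : (1 + M).det = ∏ i, (1 + hM.1.eigenvalues i) := by
    have h := congrArg (Polynomial.eval (-1)) hM.1.charpoly_eq
    rw [Matrix.eval_charpoly, Polynomial.eval_prod] at h
    have h1 : Matrix.scalar n (-1 : ℝ) - M = -(1 + M) := by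
      rw [map_neg, map_one]; abel
    have h2 : ∀ i, Polynomial.eval (-1 : ℝ)
        (Polynomial.X - Polynomial.C ((hM.1.eigenvalues i : ℝ))) =
          (-1) * (1 + hM.1.eigenvalues i) := by
      intro i
      simp only [Polynomial.eval_sub, Polynomial.eval_X, Polynomial.eval_C]
      ring
    rw [h1, Matrix.det_neg] at h
    simp only [RCLike.ofReal_real_eq_id, id] at h
    rw [Finset.prod_congr rfl (fun i _ => h2 i), Finset.prod_mul_distrib, Finset.prod_const,
      Finset.card_univ] at h
    exact mul_left_cancel₀ (pow_ne_zero _ (by norm_num)) h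
  have htr : M.trace = ∑ i, hM.1.eigenvalues i := by
    simpa using hM.1.trace_eq_sum_eigenvalues
  have hkey : ∀ s : Finset n,
      1 + ∑ i ∈ s, hM.1.eigenvalues i ≤ ∏ i ∈ s, (1 + hM.1.eigenvalues i) := by
    intro s
    induction s using Finset.induction_on with
    | empty => simp
    | insert a s ha ih =>
      rw [Finset.sum_insert ha, Finset.prod_insert ha]
      have h0 := hM.eigenvalues_nonneg a
      have hs : 0 ≤ ∑ i ∈ s, hM.1.eigenvalues i :=
        Finset.sum_nonneg fun i _ => hM.eigenvalues_nonneg i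
      nlinarith [mul_le_mul_of_nonneg_left ih (by linarith : 0 ≤ 1 + hM.1.eigenvalues a),
        mul_nonneg h0 hs]
  rw [hprod, htr]
  exact hkey univ

open Matrix MatrixOrder in
theorem det_mul_one_add_trace_le_det_add {n : Type*} [Fintype n] [DecidableEq n]
    {A P : Matrix n n ℝ} (hA : A.PosDef) (hP : P.PosSemidef) :
    A.det * (1 + (P * A⁻¹).trace) ≤ (A + P).det := by
  obtain ⟨C, hC⟩ := CStarAlgebra.nonneg_iff_eq_star_mul_self.mp hA.inv.posSemidef.nonneg
  rw [star_eq_conjTranspose] at hC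
  have hunit : IsUnit A.det := (Matrix.isUnit_iff_isUnit_det A).mp hA.isUnit
  have hfac : A + P = (1 + P * A⁻¹) * A := by
    rw [add_mul, one_mul, Matrix.mul_assoc, Matrix.nonsing_inv_mul A hunit, Matrix.mul_one]
  have hdet : (1 + P * A⁻¹).det = (1 + C * P * Cᴴ).det := by
    rw [hC, ← Matrix.mul_assoc, Matrix.det_one_add_mul_comm, Matrix.mul_assoc C]
  have htr : (P * A⁻¹).trace = (C * P * Cᴴ).trace := by
    rw [hC, ← Matrix.mul_assoc, Matrix.trace_mul_comm, Matrix.mul_assoc C]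
  rw [hfac, Matrix.det_mul, mul_comm, hdet, htr]
  exact mul_le_mul_of_nonneg_right
    (one_add_trace_le_det_one_add (hP.mul_mul_conjTranspose_same C)) hA.det_pos.le

open Matrix in
/-- If `A = c • 1 + P` with `P` positive semidefinite, the quadratic form of `A⁻¹` is bounded by
that of `c⁻¹ • 1`. -/
theorem dotProduct_inv_mulVec_le {n : Type*} [Fintype n] [DecidableEq n]
    {P : Matrix n n ℝ} (hP : P.PosSemidef) {c : ℝ} (hc : 0 < c)
    (hA : (c • (1 : Matrix n n ℝ) + P).PosDef) (v : n → ℝ) :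
    v ⬝ᵥ (c • (1 : Matrix n n ℝ) + P)⁻¹.mulVec v ≤ (v ⬝ᵥ v) / c := by
  set A := c • (1 : Matrix n n ℝ) + P with hAdef
  have hunit : IsUnit A.det := (Matrix.isUnit_iff_isUnit_det A).mp hA.isUnit
  set y := A⁻¹.mulVec v with hy
  have hAy : A.mulVec y = v := by
    rw [hy, Matrix.mulVec_mulVec, Matrix.mul_nonsing_inv A hunit, Matrix.one_mulVec]
  have h1 : c * (y ⬝ᵥ y) ≤ v ⬝ᵥ y := by
    have h2 := hP.dotProduct_mulVec_nonneg y
    have h3 : v ⬝ᵥ y = c * (y ⬝ᵥ y) + y ⬝ᵥ P.mulVec y := by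
      conv_lhs => rw [← hAy]
      rw [dotProduct_comm, hAdef, Matrix.add_mulVec, Matrix.smul_mulVec, Matrix.one_mulVec,
        dotProduct_add, dotProduct_smul, smul_eq_mul]
    rw [star_trivial] at h2
    linarith
  have h4 : 0 ≤ (c • y - v) ⬝ᵥ (c • y - v) := by
    simpa using dotProduct_star_self_nonneg (c • y - v)
  have h5 : (c • y - v) ⬝ᵥ (c • y - v) = c ^ 2 * (y ⬝ᵥ y) - 2 * c * (v ⬝ᵥ y) + v ⬝ᵥ v := by
    simp only [sub_dotProduct, dotProduct_sub, smul_dotProduct, dotProduct_smul, smul_eq_mul,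
      dotProduct_comm y v]
    ring
  rw [le_div_iff₀ hc]
  nlinarith [mul_le_mul_of_nonneg_left h1 hc.le]

open Matrix in
/-- AM-GM for the eigenvalues, in logarithmic form. -/
theorem log_det_le_of_trace_le {n : Type*} [Fintype n] [DecidableEq n]
    {A : Matrix n n ℝ} (hA : A.PosDef) {μ : ℝ} (hμ : 0 < μ)
    (htr : A.trace ≤ Fintype.card n * μ) :
    Real.log A.det ≤ Fintype.card n * Real.log μ := by
  have hdet : A.det = ∏ i, hA.1.eigenvalues i := by
    simpa using hA.1.det_eq_prod_eigenvalues
  have htrace : A.trace = ∑ i, hA.1.eigenvalues i := by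
    simpa using hA.1.trace_eq_sum_eigenvalues
  rw [hdet, Real.log_prod (fun i _ => (hA.eigenvalues_pos i).ne')]
  have h1 : ∀ i, Real.log (hA.1.eigenvalues i) ≤
      Real.log μ + (hA.1.eigenvalues i / μ - 1) := by
    intro i
    have h := Real.log_le_sub_one_of_pos (div_pos (hA.eigenvalues_pos i) hμ)
    rw [Real.log_div (hA.eigenvalues_pos i).ne' hμ.ne'] at h
    linarith
  refine (Finset.sum_le_sum fun i _ => h1 i).trans ?_
  rw [Finset.sum_add_distrib, Finset.sum_sub_distrib, ← Finset.sum_div, ← htrace]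
  simp only [Finset.sum_const, Finset.card_univ, nsmul_eq_mul, mul_one]
  have h2 : A.trace / μ ≤ Fintype.card n := (div_le_iff₀ hμ).mpr htr
  linarith

theorem le_two_mul_log_one_add {s : ℝ} (h0 : 0 ≤ s) (h1 : s ≤ 1) : s ≤ 2 * Real.log (1 + s) := by
  have h := Real.le_log_one_add_of_nonneg h0
  have h2 : s / 2 ≤ 2 * s / (s + 2) := by
    rw [div_le_div_iff₀ (by norm_num) (by linarith)]
    nlinarith
  linarith

/-- Elliptical potential bound (equation (41) of the paper) for the ridge
regression design matrices of FW-LinUCBRank. -/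
theorem elliptical_potential_ranking (d m T kbar : ℕ)
    (hd : 0 < d) (hm : 0 < m) (hT : 0 < T) (hkbar : 0 < kbar) (hkm : kbar ≤ m)
    (DX lam : ℝ) (hDX : 0 < DX) (hlam : DX ^ 2 * kbar ≤ lam)
    (x : ℕ → ℕ → (Fin d → ℝ))
    (hx : ∀ t ∈ Finset.Icc 1 T, ∀ i ∈ Finset.Icc 1 m,
      Real.sqrt (∑ j, x t i j ^ 2) ≤ DX)
    (e : ℕ → ℕ → ℝ)
    (he : ∀ t ∈ Finset.Icc 1 T, ∀ i ∈ Finset.Icc 1 m, e t i = 0 ∨ e t i = 1)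
    (hesum : ∀ t ∈ Finset.Icc 1 T, (∑ i ∈ Finset.Icc 1 m, e t i) ≤ kbar)
    (V : ℕ → Matrix (Fin d) (Fin d) ℝ)
    (hV0 : V 0 = lam • (1 : Matrix (Fin d) (Fin d) ℝ))
    (hV : ∀ t ∈ Finset.Icc 1 T,
      V t = V (t - 1) + ∑ i ∈ Finset.Icc 1 m,
        e t i • vecMulVec (x t i) (x t i)) :
    (∑ t ∈ Finset.Icc 1 T, ∑ i ∈ Finset.Icc 1 m,
        e t i * (x t i ⬝ᵥ (V (t - 1))⁻¹.mulVec (x t i))) ≤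
      2 * Real.log ((V T).det / (V 0).det) ∧
    2 * Real.log ((V T).det / (V 0).det) ≤
      2 * d * Real.log (1 + T * DX ^ 2 * kbar / (lam * d)) := by
  have hk : (0 : ℝ) < kbar := by exact_mod_cast hkbar
  have hd' : (0 : ℝ) < d := by exact_mod_cast hd
  have hlam0 : 0 < lam := lt_of_lt_of_le (by positivity) hlam
  set Q : ℕ → Matrix (Fin d) (Fin d) ℝ := fun t =>
    ∑ i ∈ Finset.Icc 1 m, e t i • vecMulVec (x t i) (x t i) with hQ
  have he0 : ∀ t ∈ Finset.Icc 1 T, ∀ i ∈ Finset.Icc 1 m, 0 ≤ e t i := by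
    intro t ht i hi
    rcases he t ht i hi with h | h <;> simp [h]
  have hxx : ∀ t ∈ Finset.Icc 1 T, ∀ i ∈ Finset.Icc 1 m, x t i ⬝ᵥ x t i ≤ DX ^ 2 := by
    intro t ht i hi
    have h := (Real.sqrt_le_left hDX.le).mp (hx t ht i hi)
    simpa [dotProduct, sq] using h
  have hweighted : ∀ t ∈ Finset.Icc 1 T, ∀ b : ℝ, 0 ≤ b → ∀ f : ℕ → ℝ,
      (∀ i ∈ Finset.Icc 1 m, f i ≤ b) → ∑ i ∈ Finset.Icc 1 m, e t i * f i ≤ kbar * b := by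
    intro t ht b hb f hf
    calc ∑ i ∈ Finset.Icc 1 m, e t i * f i ≤ ∑ i ∈ Finset.Icc 1 m, e t i * b :=
          Finset.sum_le_sum fun i hi => mul_le_mul_of_nonneg_left (hf i hi) (he0 t ht i hi)
      _ = (∑ i ∈ Finset.Icc 1 m, e t i) * b := by rw [Finset.sum_mul]
      _ ≤ kbar * b := mul_le_mul_of_nonneg_right (hesum t ht) hb
  have hQpsd : ∀ t ∈ Finset.Icc 1 T, (Q t).PosSemidef := by
    intro t ht
    refine Matrix.posSemidef_sum _ fun i hi => ?_
    have h := Matrix.posSemidef_vecMulVec_self_star (x t i)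
    rw [star_trivial] at h
    exact h.smul (he0 t ht i hi)
  have hQtr : ∀ t ∈ Finset.Icc 1 T, (Q t).trace ≤ kbar * DX ^ 2 := by
    intro t ht
    simp only [hQ, Matrix.trace_sum, Matrix.trace_smul, Matrix.trace_vecMulVec, smul_eq_mul]
    exact hweighted t ht _ (sq_nonneg _) _ (hxx t ht)
  have hQinv : ∀ t, ∀ A : Matrix (Fin d) (Fin d) ℝ, (Q t * A).trace =
      ∑ i ∈ Finset.Icc 1 m, e t i * (x t i ⬝ᵥ A.mulVec (x t i)) := by
    intro t A
    simp only [hQ, Finset.sum_mul, Matrix.trace_sum, Matrix.smul_mul, Matrix.trace_smul,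
      smul_eq_mul]
    refine Finset.sum_congr rfl fun i _ => ?_
    rw [Matrix.trace_mul_comm, Matrix.mul_vecMulVec, Matrix.trace_vecMulVec, dotProduct_comm]
  have hstep : ∀ t, t + 1 ≤ T → V (t + 1) = V t + Q (t + 1) := by
    intro t ht
    have h := hV (t + 1) (Finset.mem_Icc.mpr ⟨by omega, ht⟩)
    rwa [Nat.add_sub_cancel] at h
  have hposdef : ∀ P : Matrix (Fin d) (Fin d) ℝ, P.PosSemidef →
      (lam • (1 : Matrix (Fin d) (Fin d) ℝ) + P).PosDef :=
    fun P hP => (Matrix.PosDef.one.smul hlam0).add_posSemidef hP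
  have hform : ∀ t, t ≤ T → ∃ P : Matrix (Fin d) (Fin d) ℝ, P.PosSemidef ∧
      V t = lam • (1 : Matrix (Fin d) (Fin d) ℝ) + P ∧ P.trace ≤ t * (kbar * DX ^ 2) := by
    intro t
    induction t with
    | zero => exact fun _ => ⟨0, Matrix.PosSemidef.zero, by simp [hV0], by simp⟩
    | succ t ih =>
      intro ht
      obtain ⟨P, hP, hVP, htr⟩ := ih (by omega)
      have hmem : t + 1 ∈ Finset.Icc 1 T := Finset.mem_Icc.mpr ⟨by omega, ht⟩
      refine ⟨P + Q (t + 1), hP.add (hQpsd _ hmem), ?_, ?_⟩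
      · rw [hstep t ht, hVP, add_assoc]
      · rw [Matrix.trace_add]
        push_cast
        linarith [hQtr _ hmem]
  have hVpd : ∀ t, t ≤ T → (V t).PosDef := by
    intro t ht
    obtain ⟨P, hP, hVP, -⟩ := hform t ht
    exact hVP ▸ hposdef P hP
  have hround : ∀ t, t + 1 ≤ T →
      ∑ i ∈ Finset.Icc 1 m, e (t + 1) i * (x (t + 1) i ⬝ᵥ (V t)⁻¹.mulVec (x (t + 1) i)) ≤
        2 * (Real.log (V (t + 1)).det - Real.log (V t).det) := by
    intro t ht
    have hmem : t + 1 ∈ Finset.Icc 1 T := Finset.mem_Icc.mpr ⟨by omega, ht⟩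
    have hpd := hVpd t (by omega)
    set S := ∑ i ∈ Finset.Icc 1 m,
      e (t + 1) i * (x (t + 1) i ⬝ᵥ (V t)⁻¹.mulVec (x (t + 1) i)) with hS
    have hS0 : 0 ≤ S := by
      refine Finset.sum_nonneg fun i hi => mul_nonneg (he0 _ hmem i hi) ?_
      simpa using hpd.inv.posSemidef.dotProduct_mulVec_nonneg (x (t + 1) i)
    have hS1 : S ≤ 1 := by
      obtain ⟨P, hP, hVP, -⟩ := hform t (by omega)
      have hb : S ≤ kbar * (DX ^ 2 / lam) := by
        refine hweighted _ hmem _ (by positivity) _ fun i hi => ?_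
        rw [hVP]
        exact (dotProduct_inv_mulVec_le hP hlam0 (hposdef P hP) _).trans
          (div_le_div_of_nonneg_right (hxx _ hmem i hi) hlam0.le)
      refine hb.trans ?_
      rw [← mul_div_assoc, div_le_one hlam0]
      linarith
    have hdet := det_mul_one_add_trace_le_det_add hpd (hQpsd _ hmem)
    rw [hQinv, ← hS, ← hstep t ht] at hdet
    have hlog := Real.log_le_log (mul_pos hpd.det_pos (by linarith)) hdet
    rw [Real.log_mul hpd.det_pos.ne' (by linarith)] at hlog
    linarith [le_two_mul_log_one_add hS0 hS1]
  have hsum : ∀ n, n ≤ T → ∑ t ∈ Finset.Icc 1 n, ∑ i ∈ Finset.Icc 1 m,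
      e t i * (x t i ⬝ᵥ (V (t - 1))⁻¹.mulVec (x t i)) ≤
        2 * (Real.log (V n).det - Real.log (V 0).det) := by
    intro n
    induction n with
    | zero => simp
    | succ n ih =>
      intro hn
      rw [Finset.sum_Icc_succ_top (by omega), Nat.add_sub_cancel]
      linarith [ih (by omega), hround n hn]
  rw [Real.log_div (hVpd T le_rfl).det_pos.ne' (hVpd 0 (Nat.zero_le _)).det_pos.ne']
  refine ⟨hsum T le_rfl, ?_⟩
  obtain ⟨P, -, hVP, htr⟩ := hform T le_rfl
  set r : ℝ := 1 + T * DX ^ 2 * kbar / (lam * d) with hr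
  have hr0 : 0 < r := by positivity
  have hupper : Real.log (V T).det ≤ d * Real.log (lam * r) := by
    have h := log_det_le_of_trace_le (hVpd T le_rfl) (mul_pos hlam0 hr0) (by
      have hexp : (d : ℝ) * (lam * r) = lam * d + T * (kbar * DX ^ 2) := by
        rw [hr]; field_simp
      rw [Fintype.card_fin, hexp, hVP, Matrix.trace_add, Matrix.trace_smul, Matrix.trace_one,
        Fintype.card_fin, smul_eq_mul]
      linarith)
    rwa [Fintype.card_fin] at h
  have hbase : Real.log (V 0).det = d * Real.log lam := by
    rw [hV0, Matrix.det_smul, Matrix.det_one, mul_one, Fintype.card_fin, Real.log_pow]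
  rw [Real.log_mul hlam0.ne' hr0.ne'] at hupper
  rw [hbase]
  linarith
end
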